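/- Let E be a centrally orthocomplete pseudo-effect algebra, K ⊆ E a type-determining set, and c ∈ Γ(E). Then the following are equivalent: (i) c is locally type-K (i.e., c ∈ γK); (ii) every nonzero direct summand of E[0,c] contains a nonzero element of K, i.e., for every nonzero d ∈ Γ(E) with d ≤ c there exists a nonzero element of K in E[0,d]. -/

import Mathlib

namespace PEApaper

/-- The bare data of a partial-addition structure: a partial binary operation
(encoded via `Option`) together with constants `0` and `1`. -/
structure PartialStruct (E : Type) where
  padd : E → E → Option E
  zero : E
  one : E

namespace PartialStruct

variable {E : Type}

/-- `a ≤ b` iff `a + c = b` for some `c`. -/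
def le (P : PartialStruct E) (a b : E) : Prop := ∃ c, P.padd a c = some b

/-- `m` is the greatest lower bound (meet `a ∧ b`) of `a` and `b`. -/
def IsMeet (P : PartialStruct E) (a b m : E) : Prop :=
  P.le m a ∧ P.le m b ∧ ∀ x, P.le x a → P.le x b → P.le x m

/-- `j` is the least upper bound (join `a ∨ b`) of `a` and `b`. -/
def IsJoin (P : PartialStruct E) (a b j : E) : Prop :=
  P.le a j ∧ P.le b j ∧ ∀ x, P.le a x → P.le b x → P.le j x

/-- `s` is the supremum of the set `S`. -/
def IsSup (P : PartialStruct E) (S : Set E) (s : E) : Prop :=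
  (∀ x ∈ S, P.le x s) ∧ ∀ u, (∀ x ∈ S, P.le x u) → P.le s u

/-- Left-associated partial sum of a list, continuing from `acc`. -/
def IsSumFrom (P : PartialStruct E) : E → List E → E → Prop
  | acc, [], s => s = acc
  | acc, a :: l, s => ∃ t, P.padd acc a = some t ∧ IsSumFrom P t l s

/-- `s` is the (left-associated) orthosum `e₁ + e₂ + ⋯ + eₙ` of the list. -/
def IsSumList (P : PartialStruct E) (l : List E) (s : E) : Prop :=
  match l with
  | [] => s = P.zero
  | a :: t => IsSumFrom P a t s

/-- `c` is a central element: there is a PEA-isomorphism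
`f : E → E[0,c] × E[0,c∼]` with `f c = (c,0)` such that `f x = (x₁,x₂)`
implies `x = x₁ + x₂`.  The isomorphism onto the product of the two
interval pseudo-effect algebras is spelled out explicitly. -/
def IsCentral (P : PartialStruct E) (c : E) : Prop :=
  ∃ cs, P.padd c cs = some P.one ∧
    ∃ f : E → E × E,
      (∀ x, P.le (f x).1 c ∧ P.le (f x).2 cs) ∧
      Function.Injective f ∧
      (∀ y : E × E, P.le y.1 c → P.le y.2 cs → ∃ x, f x = y) ∧
      f c = (c, P.zero) ∧
      f P.one = (c, cs) ∧
      (∀ x, P.padd (f x).1 (f x).2 = some x) ∧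
      (∀ a b ab, P.padd a b = some ab →
        P.padd (f a).1 (f b).1 = some (f ab).1 ∧
        P.padd (f a).2 (f b).2 = some (f ab).2) ∧
      (∀ a b s t, P.padd (f a).1 (f b).1 = some s → P.le s c →
        P.padd (f a).2 (f b).2 = some t → P.le t cs →
        ∃ ab, P.padd a b = some ab)

/-- The center `Γ(E)`. -/
def center (P : PartialStruct E) : Set E := {c | P.IsCentral c}

/-- The central interval `Γ(E)[0,c] = Γ(E) ∩ E[0,c]`. -/
def centerIntervalSet (P : PartialStruct E) (c : E) : Set E :=
  {x | P.IsCentral x ∧ P.le x c}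

/-- A Γ-orthogonal family: one dominated elementwise by a pairwise
disjoint family of central elements. -/
def GammaOrthogonal (P : PartialStruct E) {I : Type} (e : I → E) : Prop :=
  ∃ c : I → E, (∀ i, P.IsCentral (c i)) ∧
    (∀ i j, i ≠ j → P.IsMeet (c i) (c j) P.zero) ∧
    ∀ i, P.le (e i) (c i)

/-- Centrally orthocomplete: every Γ-orthogonal family has a supremum. -/
def IsCOPEA (P : PartialStruct E) : Prop :=
  ∀ (I : Type) (e : I → E), P.GammaOrthogonal e → ∃ s, P.IsSup (Set.range e) s

/-- `c` is the central cover of `e`: the smallest central element above `e`. -/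
def IsCentralCover (P : PartialStruct E) (c e : E) : Prop :=
  P.IsCentral c ∧ P.le e c ∧ ∀ d, P.IsCentral d → P.le e d → P.le c d

/-- `[Q]`: the set of all suprema of Γ-orthogonal families of elements of `Q`. -/
def bra (P : PartialStruct E) (Q : Set E) : Set E :=
  {s | ∃ (I : Type) (e : I → E), (∀ i, e i ∈ Q) ∧ P.GammaOrthogonal e ∧
    P.IsSup (Set.range e) s}

/-- `Q^γ = {q ∧ c : q ∈ Q, c ∈ Γ(E)}`. -/
def gammaClosure (P : PartialStruct E) (Q : Set E) : Set E :=
  {m | ∃ q ∈ Q, ∃ c, P.IsCentral c ∧ P.IsMeet q c m}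

/-- `Q↓ = ⋃_{q ∈ Q} E[0,q]`. -/
def downSet (P : PartialStruct E) (Q : Set E) : Set E :=
  {e | ∃ q ∈ Q, P.le e q}

/-- `Q' = {e ∈ E : q ∧ e = 0 for all q ∈ Q}`. -/
def commutant (P : PartialStruct E) (Q : Set E) : Set E :=
  {e | ∀ q ∈ Q, P.IsMeet q e P.zero}

/-- A type-determining (TD) set: `K = [K] = K^γ`. -/
def IsTD (P : PartialStruct E) (K : Set E) : Prop :=
  P.bra K = K ∧ P.gammaClosure K = K

/-- A strongly type-determining (STD) set: `K = [K] = K↓`. -/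
def IsSTD (P : PartialStruct E) (K : Set E) : Prop :=
  P.bra K = K ∧ P.downSet K = K

/-- `c` is the type-cover of `K` (w.r.t. the central cover map `γ`):
the unique central element with `γK = Γ(E)[0,c]`. -/
def IsTypeCover (P : PartialStruct E) (γ : E → E) (K : Set E) (c : E) : Prop :=
  P.IsCentral c ∧ γ '' K = P.centerIntervalSet c

/-- An atom: a nonzero element with no proper nonzero subelement. -/
def IsAtom' (P : PartialStruct E) (a : E) : Prop :=
  a ≠ P.zero ∧ ∀ x, P.le x a → x = P.zero ∨ x = a

end PartialStruct

/-- A PEA-isomorphism between two partial-addition structures: a bijective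
morphism whose inverse is a morphism. -/
structure IsPEAIso {A B : Type} (P : PartialStruct A) (Q : PartialStruct B)
    (f : A → B) : Prop where
  bijective : Function.Bijective f
  map_one : f P.one = Q.one
  map_add : ∀ a b ab, P.padd a b = some ab → Q.padd (f a) (f b) = some (f ab)
  rev_add : ∀ a b s, Q.padd (f a) (f b) = some s → ∃ ab, P.padd a b = some ab

open scoped Classical in
/-- The (coordinatewise) product of a family of partial structures. -/
noncomputable def prodStruct {I : Type} {A : I → Type}
    (Ps : ∀ i, PartialStruct (A i)) : PartialStruct (∀ i, A i) where
  padd a b :=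
    if h : ∀ i, ∃ s, (Ps i).padd (a i) (b i) = some s
    then some fun i => Classical.choose (h i)
    else none
  zero := fun i => (Ps i).zero
  one := fun i => (Ps i).one

/-- A pseudo-effect algebra. -/
structure PEA (E : Type) extends PartialStruct E where
  assoc_def : ∀ a b c : E,
    (∃ ab, padd a b = some ab ∧ ∃ x, padd ab c = some x) ↔
    (∃ bc, padd b c = some bc ∧ ∃ y, padd a bc = some y)
  assoc_eq : ∀ a b c ab bc x y, padd a b = some ab → padd ab c = some x →
    padd b c = some bc → padd a bc = some y → x = y
  exu_right : ∀ a : E, ∃! d, padd a d = some one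
  exu_left : ∀ a : E, ∃! e, padd e a = some one
  shift : ∀ a b ab, padd a b = some ab →
    (∃ d, padd d a = some ab) ∧ (∃ e, padd b e = some ab)
  one_add : ∀ a x, padd one a = some x → a = zero
  add_one : ∀ a x, padd a one = some x → a = zero

namespace PEA

variable {E : Type} (P : PEA E)

/-- Shorthand for the underlying partial structure. -/
abbrev ps : PartialStruct E := P.toPartialStruct

theorem one_add_zero : P.padd P.one P.zero = some P.one := by
  obtain ⟨d, hd, -⟩ := P.exu_right P.one
  have h := P.one_add d P.one hd
  rwa [h] at hd

theorem zero_add_one : P.padd P.zero P.one = some P.one := by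
  obtain ⟨e, he, -⟩ := P.exu_left P.one
  have h := P.add_one e P.one he
  rwa [h] at he

theorem padd_zero (a : E) : P.padd a P.zero = some a := by
  obtain ⟨e, he, -⟩ := P.exu_left a
  have h1 : ∃ ab, P.padd e a = some ab ∧ ∃ x, P.padd ab P.zero = some x :=
    ⟨P.one, he, P.one, P.one_add_zero⟩
  obtain ⟨t, ht, y, hy⟩ := (P.assoc_def e a P.zero).mp h1
  have hxy : P.one = y :=
    P.assoc_eq e a P.zero P.one t P.one y he P.one_add_zero ht hy
  obtain ⟨d, hd, hu⟩ := P.exu_right e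
  have hta : t = a := by
    have h2 : t = d := hu t (by rw [← hxy] at hy; exact hy)
    have h3 : a = d := hu a he
    rw [h2, h3]
  rwa [hta] at ht

theorem zero_padd (a : E) : P.padd P.zero a = some a := by
  obtain ⟨d, hd, -⟩ := P.exu_right a
  have h1 : ∃ bc, P.padd a d = some bc ∧ ∃ y, P.padd P.zero bc = some y :=
    ⟨P.one, hd, P.one, P.zero_add_one⟩
  obtain ⟨t, ht, y, hy⟩ := (P.assoc_def P.zero a d).mpr h1
  have hxy : y = P.one :=
    P.assoc_eq P.zero a d t P.one y P.one ht hy hd P.zero_add_one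
  obtain ⟨e, he, hu⟩ := P.exu_left d
  have hta : t = a := by
    have h2 : t = e := hu t (by rw [hxy] at hy; exact hy)
    have h3 : a = e := hu a hd
    rw [h2, h3]
  rwa [hta] at ht

theorem zero_le (a : E) : P.ps.le P.zero a := ⟨a, P.zero_padd a⟩

theorem le_refl (a : E) : P.ps.le a a := ⟨P.zero, P.padd_zero a⟩

open scoped Classical in
/-- The interval pseudo-effect algebra `E[0,p]` as a partial structure on
the subtype `{x // x ≤ p}`; the sum is defined iff it is defined in `E`
and lies below `p`, and the unit is `p`. -/
noncomputable def intervalStruct (p : E) :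
    PartialStruct {x : E // P.ps.le x p} where
  padd a b := (P.padd a.1 b.1).bind fun s =>
    if h : P.ps.le s p then some ⟨s, h⟩ else none
  zero := ⟨P.zero, P.zero_le p⟩
  one := ⟨p, P.le_refl p⟩

end PEA

/-- The order relation of a complete Boolean algebra structure, made explicit. -/
def cbaLe {X : Type} (inst : CompleteBooleanAlgebra X) (a b : X) : Prop :=
  @LE.le X (by letI := inst; exact inferInstance) a b

end PEApaper

namespace PEApaper.PEA

variable {E : Type} (P : PEA E)

theorem eq_zero_of_padd_self {a w : E} (h : P.padd a w = some a) : w = P.zero := by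
  obtain ⟨d, hd, -⟩ := P.exu_left a
  obtain ⟨ab, hab, x, hx⟩ := (P.assoc_def d a w).mpr ⟨a, h, P.one, hd⟩
  rw [hd] at hab
  cases hab
  exact P.one_add w x hx

theorem left_eq_zero_of_padd_eq_zero {x y : E} (h : P.padd x y = some P.zero) :
    x = P.zero := by
  obtain ⟨ab, hab, -⟩ := (P.assoc_def P.one x y).mpr ⟨P.zero, h, P.one, P.one_add_zero⟩
  exact P.one_add x ab hab

theorem le_trans {a b c : E} (hab : P.ps.le a b) (hbc : P.ps.le b c) : P.ps.le a c := by
  obtain ⟨x, hx⟩ := hab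
  obtain ⟨y, hy⟩ := hbc
  obtain ⟨w, hw, z, hz⟩ := (P.assoc_def a x y).mp ⟨b, hx, c, hy⟩
  have h := P.assoc_eq a x y b w c z hx hy hw hz
  exact ⟨w, h ▸ hz⟩

theorem le_antisymm {a b : E} (hab : P.ps.le a b) (hba : P.ps.le b a) : a = b := by
  obtain ⟨x, hx⟩ := hab
  obtain ⟨y, hy⟩ := hba
  obtain ⟨w, hw, z, hz⟩ := (P.assoc_def a x y).mp ⟨b, hx, a, hy⟩
  have h := P.assoc_eq a x y b w a z hx hy hw hz
  rw [← h] at hz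
  rw [P.eq_zero_of_padd_self hz] at hw
  rw [P.left_eq_zero_of_padd_eq_zero hw, P.padd_zero] at hx
  exact Option.some.inj hx

theorem eq_zero_of_le_zero {a : E} (h : P.ps.le a P.zero) : a = P.zero :=
  P.le_antisymm h (P.zero_le a)

theorem le_of_padd_right {a b s : E} (h : P.padd a b = some s) : P.ps.le b s :=
  (P.shift a b s h).2

/-- A central element `c` has a central complement `cs`, disjoint from `c`, and every `x`
decomposes as `x = x₁ + x₂`, where `x₁ = x ∧ c` and `x₂ ≤ cs`. -/
theorem exists_central_complement {c : E} (hc : P.ps.IsCentral c) :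
    ∃ cs, P.ps.IsCentral cs ∧ (∀ x, P.ps.le x c → P.ps.le x cs → x = P.zero) ∧
      ∀ x, ∃ x₁ x₂, P.padd x₁ x₂ = some x ∧ P.ps.IsMeet x c x₁ ∧ P.ps.le x₂ cs := by
  obtain ⟨cs, -, f, hle, hinj, hsurj, hfc, hf1, hsum, hadd, hdef⟩ := hc
  have hfl : ∀ x, P.ps.le x c → f x = (x, P.zero) := by
    intro x hx
    obtain ⟨z, hz⟩ := hsurj (x, P.zero) hx (P.zero_le cs)
    have h := hsum z
    rw [hz] at h
    have h' : some x = some z := (P.padd_zero x).symm.trans h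
    rw [Option.some.inj h', hz, Option.some.inj h']
  have hfr : ∀ x, P.ps.le x cs → f x = (P.zero, x) := by
    intro x hx
    obtain ⟨z, hz⟩ := hsurj (P.zero, x) (P.zero_le c) hx
    have h := hsum z
    rw [hz] at h
    have h' : some x = some z := (P.zero_padd x).symm.trans h
    rw [Option.some.inj h', hz, Option.some.inj h']
  have hcomm : ∀ x, P.padd (f x).2 (f x).1 = some x := by
    intro x
    have e1 := hfl _ (hle x).1
    have e2 := hfr _ (hle x).2
    obtain ⟨z, hz⟩ := hdef (f x).2 (f x).1 (f x).1 (f x).2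
      (by rw [e1, e2]; exact P.zero_padd _) (hle x).1
      (by rw [e1, e2]; exact P.padd_zero _) (hle x).2
    obtain ⟨h1, h2⟩ := hadd _ _ _ hz
    rw [e1, e2] at h1 h2
    have h1' := Option.some.inj ((P.zero_padd _).symm.trans h1)
    have h2' := Option.some.inj ((P.padd_zero _).symm.trans h2)
    rw [hz, hinj (Prod.ext h1' h2' : f x = f z)]
  refine ⟨cs, ⟨c, ?_, fun x => ((f x).2, (f x).1), fun x => ⟨(hle x).2, (hle x).1⟩, ?_, ?_,
    ?_, ?_, hcomm, fun a b ab h => ⟨(hadd a b ab h).2, (hadd a b ab h).1⟩,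
    fun a b s t hs hsc ht htc => hdef a b t s ht htc hs hsc⟩, ?_, ?_⟩
  · have h := hcomm P.one
    rwa [hf1] at h
  · intro x y h
    exact hinj (Prod.ext (Prod.ext_iff.mp h).2 (Prod.ext_iff.mp h).1)
  · rintro ⟨y₁, y₂⟩ h1 h2
    obtain ⟨x, hx⟩ := hsurj (y₂, y₁) h2 h1
    exact ⟨x, by simp [hx]⟩
  · simp [hfr cs (P.le_refl cs)]
  · simp [hf1]
  · intro x h1 h2
    have h := (hfl x h1).symm.trans (hfr x h2)
    exact (Prod.ext_iff.mp h).1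
  · intro x
    refine ⟨(f x).1, (f x).2, hsum x, ⟨⟨_, hsum x⟩, (hle x).1, ?_⟩, (hle x).2⟩
    rintro y ⟨z, hz⟩ hyc
    have h := (hadd _ _ _ hz).1
    rw [hfl y hyc] at h
    exact ⟨_, h⟩

theorem isMeet_zero_of_forall {a b : E}
    (h : ∀ x, P.ps.le x a → P.ps.le x b → x = P.zero) : P.ps.IsMeet a b P.zero :=
  ⟨P.zero_le a, P.zero_le b, fun x ha hb => h x ha hb ▸ P.le_refl x⟩

theorem exists_maximal_gamma_disjoint (γ : E → E) (K : Set E) (c : E) :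
    ∃ S : Set E, Maximal (fun S : Set E => (∀ k ∈ S, k ∈ K ∧ P.ps.le (γ k) c) ∧
      S.Pairwise fun a b => P.ps.IsMeet (γ a) (γ b) P.zero) S := by
  refine zorn_subset {S : Set E | (∀ k ∈ S, k ∈ K ∧ P.ps.le (γ k) c) ∧
      S.Pairwise fun a b => P.ps.IsMeet (γ a) (γ b) P.zero} fun C hC hchain =>
    ⟨⋃₀ C, ⟨?_, ?_⟩, fun s hs => Set.subset_sUnion_of_mem hs⟩
  · rintro k ⟨s, hs, hk⟩
    exact (hC hs).1 k hk
  · exact (Set.pairwise_sUnion hchain.directedOn).2 fun s hs => (hC hs).2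

end PEApaper.PEA

open PEApaper PEApaper.PartialStruct in
/-- Corollary 5.4(bis): in a COPEA, for a TD set `K` and `c ∈ Γ(E)`:
`c` is locally type-`K` (i.e. `c ∈ γK`) iff every nonzero direct summand of
`E[0,c]` (i.e. every nonzero central `d ≤ c`) contains a nonzero element
of `K`. -/
theorem stmt14 {E : Type} (P : PEA E) (hco : P.ps.IsCOPEA)
    (γ : E → E) (hγ : ∀ e, P.ps.IsCentralCover (γ e) e)
    (K : Set E) (hK : P.ps.IsTD K)
    (c : E) (hc : P.ps.IsCentral c) :
    c ∈ γ '' K ↔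
      ∀ d, P.ps.IsCentral d → P.ps.le d c → d ≠ P.ps.zero →
        ∃ k ∈ K, P.ps.le k d ∧ k ≠ P.ps.zero := by
  constructor
  · rintro ⟨k, hkK, rfl⟩ d hd hdc hd0
    obtain ⟨ds, hds, hdisj, hdec⟩ := P.exists_central_complement hd
    obtain ⟨k₁, k₂, hsum, hmeet, hk₂⟩ := hdec k
    refine ⟨k₁, hK.2 ▸ ⟨k, hkK, d, hd, hmeet⟩, hmeet.2.1, fun h0 => hd0 ?_⟩
    have hkk : k₂ = k := by
      rw [h0] at hsum
      exact Option.some.inj ((P.zero_padd k₂).symm.trans hsum)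
    rw [hkk] at hk₂
    exact hdisj d (P.le_refl d) (P.le_trans hdc ((hγ k).2.2 ds hds hk₂))
  · intro H
    obtain ⟨S, ⟨hSK, hSpw⟩, hmax⟩ := P.exists_maximal_gamma_disjoint γ K c
    have horth : P.ps.GammaOrthogonal (fun k : S => (k : E)) :=
      ⟨fun k => γ k, fun k => (hγ k).1,
        fun i j hij => hSpw i.2 j.2 fun h => hij (Subtype.ext h), fun k => (hγ k).2.1⟩
    obtain ⟨s, hs⟩ := hco S _ horth
    have hsK : s ∈ K := by
      rw [← hK.1]
      exact ⟨S, fun k => (k : E), fun k => (hSK k k.2).1, horth, hs⟩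
    have hγsc : P.ps.le (γ s) c := by
      refine (hγ s).2.2 c hc (hs.2 c ?_)
      rintro _ ⟨k, rfl⟩
      exact P.le_trans (hγ k).2.1 (hSK k k.2).2
    refine ⟨s, hsK, P.le_antisymm hγsc ?_⟩
    obtain ⟨q, hq, hdisj, hdec⟩ := P.exists_central_complement (hγ s).1
    obtain ⟨c₁, c₂, hsum, hmeet, hc₂⟩ := hdec c
    by_cases h0 : c₂ = P.zero
    · rw [h0] at hsum
      rw [← Option.some.inj ((P.padd_zero c₁).symm.trans hsum)]
      exact hmeet.2.1
    exfalso
    obtain ⟨k, hkK, hkd, hk0⟩ := H (γ c₂) (hγ c₂).1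
      ((hγ c₂).2.2 c hc (P.le_of_padd_right hsum))
      fun h => h0 (P.eq_zero_of_le_zero (h ▸ (hγ c₂).2.1))
    have hγk : P.ps.le (γ k) (γ c₂) := (hγ k).2.2 _ (hγ c₂).1 hkd
    have hγkq : P.ps.le (γ k) q := P.le_trans hγk ((hγ c₂).2.2 q hq hc₂)
    have hγS : ∀ a ∈ S, P.ps.le (γ a) (γ s) := fun a ha =>
      (hγ a).2.2 _ (hγ s).1 (P.le_trans (hs.1 a ⟨⟨a, ha⟩, rfl⟩) (hγ s).2.1)
    have hkS : k ∈ S := by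
      refine hmax (y := insert k S) ⟨?_, ?_⟩ (Set.subset_insert k S) (Set.mem_insert k S)
      · rintro a (rfl | ha)
        · exact ⟨hkK, P.le_trans hγk ((hγ c₂).2.2 c hc (P.le_of_padd_right hsum))⟩
        · exact hSK a ha
      · refine hSpw.insert fun a ha _ => ⟨P.isMeet_zero_of_forall fun x hx hxa => ?_,
          P.isMeet_zero_of_forall fun x hxa hx => ?_⟩ <;>
        exact hdisj x (P.le_trans hxa (hγS a ha)) (P.le_trans hx hγkq)
    exact hk0 (hdisj k (P.le_trans (hγ k).2.1 (hγS k hkS)) (P.le_trans (hγ k).2.1 hγkq))
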